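/- arXiv:1207.3429 — 2 statements merged into one kernel-verified Lean document; each statement's English description precedes it below -/
import Mathlib

section
/- Let n ≥ 1, let Φ be the type C_n root system in ℝ^n, and let σ : Fin n → {1, −1} be a choice of signs. Then conv(Φ) ∩ {x ∈ ℝ^n : σ_i x_i ≥ 0 for all i ∈ [n]} = conv({0} ∪ {2σ_i e_i : i ∈ [n]}). (This expresses that in type C the cones on the facets of the root polytope are exactly the closed coordinate octants.) -/
theorem convex_setOf_sum_abs_le {ι : Type*} [Fintype ι] (r : ℝ) :
    Convex ℝ {x : ι → ℝ | ∑ k, |x k| ≤ r} := by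
  intro x hx y hy a b ha hb hab
  simp only [Set.mem_ofPred_eq, Pi.add_apply, Pi.smul_apply, smul_eq_mul] at hx hy ⊢
  calc ∑ k, |a * x k + b * y k| ≤ ∑ k, (a * |x k| + b * |y k|) := by
        refine Finset.sum_le_sum fun k _ => (abs_add_le _ _).trans ?_
        rw [abs_mul, abs_mul, abs_of_nonneg ha, abs_of_nonneg hb]
    _ = a * ∑ k, |x k| + b * ∑ k, |y k| := by
        rw [Finset.sum_add_distrib, Finset.mul_sum, Finset.mul_sum]
    _ ≤ a * r + b * r := by gcongr
    _ = r := by rw [← add_mul, hab, one_mul]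

theorem sum_abs_add_single_le {ι : Type*} [Fintype ι] [DecidableEq ι] (i j : ι) (a b : ℝ) :
    ∑ k, |a * (if k = i then 1 else 0) + b * (if k = j then 1 else 0)| ≤ |a| + |b| := by
  calc _ ≤ ∑ k, (|a| * (if k = i then 1 else 0) + |b| * (if k = j then 1 else 0)) := by
        refine Finset.sum_le_sum fun k _ => (abs_add_le _ _).trans (le_of_eq ?_)
        split_ifs <;> simp
    _ = |a| + |b| := by simp [Finset.sum_add_distrib]

theorem Convex.sum_smul_mem_of_sum_le_one {ι E : Type*} [Fintype ι] [AddCommGroup E] [Module ℝ E]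
    {s : Set E} (hs : Convex ℝ s) (h0 : (0 : E) ∈ s) {w : ι → ℝ} {z : ι → E}
    (hw : ∀ i, 0 ≤ w i) (hw1 : ∑ i, w i ≤ 1) (hz : ∀ i, z i ∈ s) : ∑ i, w i • z i ∈ s := by
  have h := hs.sum_mem (t := Finset.univ) (w := fun o : Option ι => o.elim (1 - ∑ i, w i) w)
    (z := fun o : Option ι => o.elim 0 z) ?_ ?_ ?_
  · simpa [Fintype.sum_option] using h
  · rintro (_ | i) _
    · simpa using hw1
    · exact hw i
  · simp [Fintype.sum_option]
  · rintro (_ | i) _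
    · exact h0
    · exact hz i

/-- Type C_n: the intersection of the root polytope with a closed coordinate octant
is the cone (inside the polytope) on the facet conv{2σ_i e_i : i ∈ [n]}. -/
theorem typeC_facet_cones_are_octants (n : ℕ) (hn : 1 ≤ n)
    (e : Fin n → (Fin n → ℝ))
    (he : ∀ i, e i = fun k => if k = i then (1 : ℝ) else 0)
    (Φ : Set (Fin n → ℝ))
    (hΦ : Φ = {v | (∃ i j : Fin n, i < j ∧
          (v = e i + e j ∨ v = e i - e j ∨ v = -e i + e j ∨ v = -e i - e j)) ∨
        (∃ i : Fin n, v = (2 : ℝ) • e i ∨ v = -((2 : ℝ) • e i))})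
    (σ : Fin n → ℝ) (hσ : ∀ i, σ i = 1 ∨ σ i = -1) :
    convexHull ℝ Φ ∩ {x | ∀ i, 0 ≤ σ i * x i}
      = convexHull ℝ ({0} ∪ {v | ∃ i : Fin n, v = (2 * σ i) • e i}) := by
  have hσσ : ∀ i, σ i * σ i = 1 := fun i => by rcases hσ i with h | h <;> simp [h]
  have hpos : ∀ i, (2 : ℝ) • e i ∈ Φ := fun i => by
    rw [hΦ]; exact Or.inr ⟨i, Or.inl rfl⟩
  have hneg : ∀ i, -((2 : ℝ) • e i) ∈ Φ := fun i => by
    rw [hΦ]; exact Or.inr ⟨i, Or.inr rfl⟩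
  apply Set.Subset.antisymm
  · rintro x ⟨hx, hxσ⟩
    have hcomb : ∀ (i j : Fin n) (a b : ℝ), |a| = 1 → |b| = 1 →
        ∑ k, |(a • e i + b • e j) k| ≤ 2 := fun i j a b ha hb => by
      have h := sum_abs_add_single_le i j a b
      rw [ha, hb] at h
      simp only [he, Pi.add_apply, Pi.smul_apply, smul_eq_mul]
      linarith
    have hsum : ∑ k, |x k| ≤ 2 := by
      refine convexHull_min ?_ (convex_setOf_sum_abs_le 2) hx
      rw [hΦ]
      rintro v (⟨i, j, -, rfl | rfl | rfl | rfl⟩ | ⟨i, rfl | rfl⟩)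
      · simpa using hcomb i j 1 1 (by simp) (by simp)
      · simpa [sub_eq_add_neg] using hcomb i j 1 (-1) (by simp) (by simp)
      · simpa using hcomb i j (-1) 1 (by simp) (by simp)
      · simpa [sub_eq_add_neg] using hcomb i j (-1) (-1) (by simp) (by simp)
      · rw [two_smul]
        simpa using hcomb i i 1 1 (by simp) (by simp)
      · rw [two_smul, neg_add]
        simpa only [neg_smul, one_smul, Set.mem_ofPred_eq] using hcomb i i (-1) (-1) (by simp) (by simp)
    have habs : ∀ i, |x i| = σ i * x i := fun i => by
      rw [← abs_of_nonneg (hxσ i), abs_mul]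
      rcases hσ i with h | h <;> simp [h]
    have hx_eq : x = ∑ i, (σ i * x i / 2) • ((2 * σ i) • e i) := by
      ext k
      have hk : ∀ i, σ i * x i / 2 * (2 * σ i) = x i := fun i => by
        linear_combination x i * hσσ i
      simp [he, smul_smul, hk]
    rw [hx_eq]
    refine Convex.sum_smul_mem_of_sum_le_one (convex_convexHull ℝ _) ?_
      (fun i => div_nonneg (hxσ i) zero_le_two) ?_ ?_
    · exact subset_convexHull ℝ _ (Or.inl rfl)
    · rw [← Finset.sum_div, ← Finset.sum_congr rfl fun i _ => habs i]
      linarith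
    · exact fun i => subset_convexHull ℝ _ (Or.inr ⟨i, rfl⟩)
  · refine convexHull_min ?_ ((convex_convexHull ℝ Φ).inter ?_)
    · rintro v (rfl | ⟨i, rfl⟩)
      · refine ⟨?_, by simp⟩
        have h := (convex_convexHull ℝ Φ) (subset_convexHull ℝ Φ (hpos ⟨0, hn⟩))
          (subset_convexHull ℝ Φ (hneg ⟨0, hn⟩)) (a := 1 / 2) (b := 1 / 2)
          (by norm_num) (by norm_num) (by norm_num)
        simpa using h
      · refine ⟨subset_convexHull ℝ Φ ?_, fun k => ?_⟩
        · rcases hσ i with h | h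
          · simpa [h] using hpos i
          · simpa [h] using hneg i
        · simp only [he, Pi.smul_apply, smul_eq_mul]
          split_ifs with h
          · subst h
            linarith [hσσ k]
          · simp
    · intro x hx y hy a b ha hb _ i
      have h1 := mul_nonneg ha (hx i)
      have h2 := mul_nonneg hb (hy i)
      simp only [Pi.add_apply, Pi.smul_apply, smul_eq_mul]
      linarith
end

section
/- Let n ≥ 1, fix i ∈ [n], and consider the type A_n setting in ℝ^{n+1} with M_i = {e_a − e_b : 1 ≤ a ≤ i < b ≤ n+1}. Let J be a dual order ideal of Φ⁺ with J ⊆ M_i, e_1 − e_{i+1} ∈ J, and e_i − e_{n+1} ∈ J. Then conv(J) is the union of the convex hulls conv(R(p)) over all staircase paths p for i whose root set R(p) is contained in J. (Thus the triangulation of the facet conv(M_i) restricts to a triangulation of the convex hull of each abelian ideal in 𝓘_ab(α_i).) -/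
/-- The `a`-th standard basis vector of `ℝ^{n+1}`, with 1-based index `a`. -/
noncomputable def stdA (n : ℕ) (a : ℕ) : Fin (n+1) → ℝ := fun j => if (j : ℕ) + 1 = a then 1 else 0

/-- A staircase path for `i` in the rectangle `M_i` of type `A_n`. -/
def IsStairA (n i : ℕ) (a b : ℕ → ℕ) : Prop :=
  a 1 = 1 ∧ b 1 = i + 1 ∧ a n = i ∧ b n = n + 1 ∧
  ∀ k, 1 ≤ k → k + 1 ≤ n →
    (a (k+1) = a k + 1 ∧ b (k+1) = b k) ∨ (a (k+1) = a k ∧ b (k+1) = b k + 1)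

/-- The root set of a staircase path in type `A_n`. -/
noncomputable def RsetA (n : ℕ) (a b : ℕ → ℕ) : Set (Fin (n+1) → ℝ) :=
  {v | ∃ k, 1 ≤ k ∧ k ≤ n ∧ v = stdA n (a k) - stdA n (b k)}

/-- A lattice path of `N` unit steps from `(a, b)` to `(i, m)`. -/
def IsLatticePath (N a b i m : ℕ) (f g : ℕ → ℕ) : Prop :=
  f 0 = a ∧ g 0 = b ∧ f N = i ∧ g N = m ∧
  ∀ k < N, (f (k + 1) = f k + 1 ∧ g (k + 1) = g k) ∨ (f (k + 1) = f k ∧ g (k + 1) = g k + 1)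

lemma IsLatticePath.cons {N a b a' b' i m : ℕ} {f g : ℕ → ℕ}
    (h : IsLatticePath N a' b' i m f g)
    (hstep : (a' = a + 1 ∧ b' = b) ∨ (a' = a ∧ b' = b + 1)) :
    IsLatticePath (N + 1) a b i m (fun k => Nat.casesOn k a f) (fun k => Nat.casesOn k b g) := by
  obtain ⟨hf, hg, hfN, hgN, hs⟩ := h
  refine ⟨rfl, rfl, hfN, hgN, ?_⟩
  rintro (_ | k) hk
  · simpa [hf, hg] using hstep
  · exact hs k (by omega)

lemma sum_Icc_eq_add_sum_Icc_succ {M : Type*} [AddCommMonoid M] (F : ℕ → M) {c d : ℕ}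
    (h : c ≤ d) : ∑ p ∈ Finset.Icc c d, F p = F c + ∑ p ∈ Finset.Icc (c + 1) d, F p := by
  rw [← Finset.insert_Icc_add_one_left_eq_Icc h, Finset.sum_insert (by simp)]

lemma sum_Icc_succ_update {M : Type*} [AddCommMonoid M] (F : ℕ → ℝ → M) (z : ℕ → ℝ)
    (c d : ℕ) (r : ℝ) :
    ∑ p ∈ Finset.Icc (c + 1) d, F p (Function.update z c r p) =
      ∑ p ∈ Finset.Icc (c + 1) d, F p (z p) := by
  refine Finset.sum_congr rfl fun p hp => ?_
  rw [Function.update_of_ne]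
  simp only [Finset.mem_Icc] at hp
  omega

lemma update_nonneg {z : ℕ → ℝ} (hz : ∀ p, 0 ≤ z p) (c : ℕ) {r : ℝ} (hr : 0 ≤ r) (p : ℕ) :
    0 ≤ Function.update z c r p := by
  by_cases hp : p = c
  · simpa [hp] using hr
  · simpa [hp] using hz p

/-- The vector `x` is a combination with nonnegative weights of total mass `s` of the vectors
`E p - E q` along a lattice path in `D` from `(a, b)` to `(i, m)`. -/
def HasPathWeight {V : Type*} [AddCommGroup V] [Module ℝ V] (E : ℕ → V) (D : ℕ → ℕ → Prop)
    (N a b i m : ℕ) (s : ℝ) (x : V) : Prop :=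
  ∃ (f g : ℕ → ℕ) (w : ℕ → ℝ), IsLatticePath N a b i m f g ∧ (∀ k ≤ N, D (f k) (g k)) ∧
    (∀ k, 0 ≤ w k) ∧ ∑ k ∈ Finset.range (N + 1), w k = s ∧
    x = ∑ k ∈ Finset.range (N + 1), w k • (E (f k) - E (g k))

lemma HasPathWeight.cons {V : Type*} [AddCommGroup V] [Module ℝ V] {E : ℕ → V}
    {D : ℕ → ℕ → Prop} {N a b a' b' i m : ℕ} {s t r : ℝ} {x y : V}
    (h : HasPathWeight E D N a' b' i m s x) (hab : D a b) (hr : 0 ≤ r)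
    (hstep : (a' = a + 1 ∧ b' = b) ∨ (a' = a ∧ b' = b + 1))
    (ht : t = s + r) (hy : y = x + r • (E a - E b)) :
    HasPathWeight E D (N + 1) a b i m t y := by
  obtain ⟨f, g, w, hp, hDp, hw, hws, hwE⟩ := h
  refine ⟨_, _, fun k => Nat.casesOn k r w, hp.cons hstep, ?_, ?_, ?_, ?_⟩
  · rintro (_ | k) hk
    · exact hab
    · exact hDp k (by omega)
  · rintro (_ | k)
    · exact hr
    · exact hw k
  · rw [Finset.sum_range_succ', ht, ← hws]
    rfl
  · rw [Finset.sum_range_succ', hy, hwE]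
    rfl

open Classical in
/-- The north-west corner rule. If `D` is closed under decreasing the first coordinate and
increasing the second, and the marginals `u`, `v` satisfy the transport feasibility condition
for `D`, then they are the marginals of a nonnegative weight carried by a lattice path in `D`. -/
lemma hasPathWeight_of_marginals {V : Type*} [AddCommGroup V] [Module ℝ V] (E : ℕ → V)
    {i m : ℕ} {D : ℕ → ℕ → Prop}
    (hD : ∀ p q p' q', D p q → 1 ≤ p' → p' ≤ p → q ≤ q' → q' ≤ m → D p' q')
    (hend : D i m) (N : ℕ) :
    ∀ (a b : ℕ) (u v : ℕ → ℝ), 1 ≤ a → a ≤ i → b ≤ m → (i - a) + (m - b) = N → D a b →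
      (∀ p, 0 ≤ u p) → (∀ q, 0 ≤ v q) →
      ∑ p ∈ Finset.Icc a i, u p = ∑ q ∈ Finset.Icc b m, v q →
      (∀ q, b ≤ q → q ≤ m →
        ∑ t ∈ Finset.Icc b q, v t ≤ ∑ p ∈ Finset.Icc a i, if D p q then u p else 0) →
      HasPathWeight E D N a b i m (∑ p ∈ Finset.Icc a i, u p)
        (∑ p ∈ Finset.Icc a i, u p • E p - ∑ q ∈ Finset.Icc b m, v q • E q) := by
  induction N with
  | zero =>
    intro a b u v ha hai hbm hN hab hu hv hsum hle
    obtain rfl : a = i := by omega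
    obtain rfl : b = m := by omega
    refine ⟨fun _ => a, fun _ => b, fun _ => u a, ⟨rfl, rfl, rfl, rfl, by simp⟩,
      fun _ _ => hab, fun _ => hu a, by simp, ?_⟩
    simp only [Finset.Icc_self, Finset.sum_singleton] at hsum
    simp [smul_sub, hsum]
  | succ N ih =>
    intro a b u v ha hai hbm hN hab hu hv hsum hle
    have hsplit := sum_Icc_eq_add_sum_Icc_succ u hai
    have hsplitv := sum_Icc_eq_add_sum_Icc_succ v hbm
    by_cases hc : b < m ∧ v b ≤ u a
    · obtain ⟨hb, hvu⟩ := hc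
      refine (ih a (b + 1) (Function.update u a (u a - v b)) v ha hai hb (by omega)
        (hD _ _ _ _ hab ha le_rfl (by omega) hb) (update_nonneg hu a (by linarith)) hv ?_ ?_).cons
        hab (hv b) (Or.inr ⟨rfl, rfl⟩) ?_ ?_
      · rw [sum_Icc_eq_add_sum_Icc_succ (Function.update u a _) hai,
          sum_Icc_succ_update (fun _ x => x)]
        simp only [Function.update_self]
        linarith
      · intro q hq hqm
        have hDa : D a q := hD _ _ _ _ hab ha le_rfl (by omega) hqm
        have := hle q (by omega) hqm
        rw [sum_Icc_eq_add_sum_Icc_succ v (by omega), sum_Icc_eq_add_sum_Icc_succ _ hai,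
          if_pos hDa] at this
        rw [sum_Icc_eq_add_sum_Icc_succ _ hai, if_pos hDa,
          sum_Icc_succ_update (fun p x => if D p q then x else 0)]
        simp only [Function.update_self]
        linarith
      · rw [sum_Icc_eq_add_sum_Icc_succ (Function.update u a _) hai,
          sum_Icc_succ_update (fun _ x => x), hsplit]
        simp only [Function.update_self]
        ring
      · rw [sum_Icc_eq_add_sum_Icc_succ (fun p => Function.update u a (u a - v b) p • E p) hai,
          sum_Icc_succ_update (fun p x => x • E p),
          sum_Icc_eq_add_sum_Icc_succ (fun p => u p • E p) hai,
          sum_Icc_eq_add_sum_Icc_succ (fun p => v p • E p) hbm]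
        simp only [Function.update_self]
        module
    · have hua : u a ≤ v b := by
        rcases hbm.lt_or_eq with hb | rfl
        · exact le_of_not_ge fun h => hc ⟨hb, h⟩
        · rw [Finset.Icc_self, Finset.sum_singleton] at hsum
          rw [← hsum]
          exact Finset.single_le_sum (fun p _ => hu p) (Finset.left_mem_Icc.2 hai)
      have hlt : a < i := by
        refine hai.lt_of_ne ?_
        rintro rfl
        refine hc ⟨by omega, ?_⟩
        rw [Finset.Icc_self, Finset.sum_singleton] at hsum
        rw [hsum]
        exact Finset.single_le_sum (fun p _ => hv p) (Finset.left_mem_Icc.2 hbm)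
      have hDstep : D (a + 1) b := by
        rcases hbm.lt_or_eq with hb | rfl
        · by_contra hn
          have h0 : ∑ p ∈ Finset.Icc (a + 1) i, (if D p b then u p else 0) = 0 := by
            refine Finset.sum_eq_zero fun p hp => if_neg fun hp' => hn ?_
            exact hD _ _ _ _ hp' (by omega) (Finset.mem_Icc.1 hp).1 le_rfl hbm
          have := hle b le_rfl hbm
          rw [sum_Icc_eq_add_sum_Icc_succ _ hai, h0, if_pos hab] at this
          simp only [Finset.Icc_self, Finset.sum_singleton, add_zero] at this
          exact hc ⟨hb, this⟩
        · exact hD _ _ _ _ hend (by omega) hlt le_rfl le_rfl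
      refine (ih (a + 1) b u (Function.update v b (v b - u a)) (by omega) hlt hbm (by omega)
        hDstep hu (update_nonneg hv b (by linarith)) ?_ ?_).cons
        hab (hu a) (Or.inl ⟨rfl, rfl⟩) ?_ ?_
      · rw [sum_Icc_eq_add_sum_Icc_succ (Function.update v b _) hbm,
          sum_Icc_succ_update (fun _ x => x)]
        simp only [Function.update_self]
        linarith
      · intro q hq hqm
        have hDa : D a q := hD _ _ _ _ hab ha le_rfl hq hqm
        have := hle q hq hqm
        rw [sum_Icc_eq_add_sum_Icc_succ v hq, sum_Icc_eq_add_sum_Icc_succ _ hai, if_pos hDa] at this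
        rw [sum_Icc_eq_add_sum_Icc_succ (Function.update v b _) hq,
          sum_Icc_succ_update (fun _ x => x)]
        simp only [Function.update_self]
        linarith
      · linarith
      · rw [sum_Icc_eq_add_sum_Icc_succ (fun p => Function.update v b (v b - u a) p • E p) hbm,
          sum_Icc_succ_update (fun p x => x • E p),
          sum_Icc_eq_add_sum_Icc_succ (fun p => u p • E p) hai,
          sum_Icc_eq_add_sum_Icc_succ (fun p => v p • E p) hbm]
        simp only [Function.update_self]
        module

open Classical in
/-- Points of the convex hull of the vectors `E p - E q` with `(p, q) ∈ D` have marginals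
satisfying the transport feasibility condition for `D`. -/
lemma exists_marginals_of_mem_convexHull {V : Type*} [AddCommGroup V] [Module ℝ V] (E : ℕ → V)
    {i l m : ℕ} {D : ℕ → ℕ → Prop}
    (hDb : ∀ p q, D p q → 1 ≤ p ∧ p ≤ i ∧ l ≤ q ∧ q ≤ m)
    (hD : ∀ p q p' q', D p q → 1 ≤ p' → p' ≤ p → q ≤ q' → q' ≤ m → D p' q')
    {x : V} (hx : x ∈ convexHull ℝ {y | ∃ p q, D p q ∧ y = E p - E q}) :
    ∃ u v : ℕ → ℝ, (∀ p, 0 ≤ u p) ∧ (∀ q, 0 ≤ v q) ∧ ∑ p ∈ Finset.Icc 1 i, u p = 1 ∧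
      ∑ q ∈ Finset.Icc l m, v q = 1 ∧
      (∀ q, l ≤ q → q ≤ m →
        ∑ t ∈ Finset.Icc l q, v t ≤ ∑ p ∈ Finset.Icc 1 i, if D p q then u p else 0) ∧
      x = ∑ p ∈ Finset.Icc 1 i, u p • E p - ∑ q ∈ Finset.Icc l m, v q • E q := by
  revert x
  apply convexHull_min
  · rintro _ ⟨p, q, hpq, rfl⟩
    obtain ⟨h1, h2, h3, h4⟩ := hDb p q hpq
    refine ⟨fun t => if t = p then 1 else 0, fun t => if t = q then 1 else 0,
      fun t => by positivity, fun t => by positivity, ?_, ?_, ?_, ?_⟩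
    · simp [h1, h2]
    · simp [h3, h4]
    · intro t ht htm
      by_cases hqt : q ≤ t
      · have hDt : D p t := hD _ _ _ _ hpq h1 le_rfl hqt htm
        have : ∀ s, (if D s t then if s = p then (1 : ℝ) else 0 else 0) =
            if s = p then 1 else 0 := by
          intro s
          by_cases hs : s = p <;> simp [hs, hDt]
        simp [this, h1, h2, h3, hqt]
      · simp only [Finset.sum_ite_eq', Finset.mem_Icc, hqt, and_false, if_false]
        exact Finset.sum_nonneg fun s _ => by positivity
    · simp [ite_smul, h1, h2, h3, h4]
  · rintro x ⟨u, v, hu, hv, hu1, hv1, hle, rfl⟩ y ⟨u', v', hu', hv', hu1', hv1', hle', rfl⟩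
      s t hs ht hst
    refine ⟨fun p => s * u p + t * u' p, fun p => s * v p + t * v' p,
      fun p => add_nonneg (mul_nonneg hs (hu p)) (mul_nonneg ht (hu' p)),
      fun p => add_nonneg (mul_nonneg hs (hv p)) (mul_nonneg ht (hv' p)), ?_, ?_, ?_, ?_⟩
    · rw [Finset.sum_add_distrib, ← Finset.mul_sum, ← Finset.mul_sum, hu1, hu1']
      linarith
    · rw [Finset.sum_add_distrib, ← Finset.mul_sum, ← Finset.mul_sum, hv1, hv1']
      linarith
    · intro q hq hqm
      have e : ∀ p, (if D p q then s * u p + t * u' p else 0) =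
          s * (if D p q then u p else 0) + t * (if D p q then u' p else 0) := by
        intro p
        split_ifs <;> simp
      simp only [e, Finset.sum_add_distrib, ← Finset.mul_sum]
      exact add_le_add (mul_le_mul_of_nonneg_left (hle q hq hqm) hs)
        (mul_le_mul_of_nonneg_left (hle' q hq hqm) ht)
    · simp only [add_smul, mul_smul, Finset.sum_add_distrib, ← Finset.smul_sum]
      module

/-- Telescoping of consecutive differences over a subinterval of `[1, n]`. -/
lemma sub_eq_sum_indicator_smul {V : Type*} [AddCommGroup V] [Module ℝ V] (E : ℕ → V)
    {n p q : ℕ} (hp : 1 ≤ p) (hpq : p ≤ q) (hq : q ≤ n + 1) :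
    E p - E q =
      ∑ k ∈ Finset.Icc 1 n, ((if p ≤ k ∧ k < q then 1 else 0 : ℕ) : ℝ) • (E k - E (k + 1)) := by
  have hsub : Finset.Ico p q ⊆ Finset.Icc 1 n := by
    intro k
    simp only [Finset.mem_Ico, Finset.mem_Icc]
    omega
  rw [← Finset.sum_subset hsub]
  · rw [← neg_sub (E q), ← Finset.sum_Ico_sub E hpq, ← Finset.sum_neg_distrib]
    refine Finset.sum_congr rfl fun k hk => ?_
    simp [Finset.mem_Ico.1 hk]
  · intro k _ hk
    rw [Finset.mem_Ico] at hk
    simp [hk]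

/-- Type A_n: the staircase triangulation of the facet conv(M_i) restricts to a
triangulation of the convex hull of each abelian ideal J ∈ 𝓘_ab(α_i). -/
theorem typeA_triangulation_restricts_to_ideal (n i : ℕ)
    (hn : 1 ≤ n) (hi1 : 1 ≤ i) (hin : i ≤ n)
    (Φpos : Set (Fin (n+1) → ℝ))
    (hΦpos : Φpos = {v | ∃ a b : ℕ, 1 ≤ a ∧ a < b ∧ b ≤ n + 1 ∧ v = stdA n a - stdA n b})
    (rle : (Fin (n+1) → ℝ) → (Fin (n+1) → ℝ) → Prop)
    (hrle : ∀ β γ, rle β γ ↔ ∃ c : ℕ → ℕ,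
        γ - β = ∑ k ∈ Finset.Icc 1 n, (c k : ℝ) • (stdA n k - stdA n (k+1)))
    (Mi : Set (Fin (n+1) → ℝ))
    (hMi : Mi = {v | ∃ a b : ℕ, 1 ≤ a ∧ a ≤ i ∧ i < b ∧ b ≤ n + 1 ∧
        v = stdA n a - stdA n b})
    (J : Set (Fin (n+1) → ℝ)) (hJM : J ⊆ Mi)
    (hJideal : ∀ β ∈ J, ∀ γ ∈ Φpos, rle β γ → γ ∈ J)
    (h1 : stdA n 1 - stdA n (i+1) ∈ J)
    (h2 : stdA n i - stdA n (n+1) ∈ J) :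
    convexHull ℝ J = {x | ∃ a b : ℕ → ℕ, IsStairA n i a b ∧ RsetA n a b ⊆ J ∧
      x ∈ convexHull ℝ (RsetA n a b)} := by
  set E := stdA n
  apply Set.Subset.antisymm
  swap
  · rintro x ⟨a, b, -, hR, hx⟩
    exact convexHull_mono hR hx
  intro x hx
  let D : ℕ → ℕ → Prop := fun p q => 1 ≤ p ∧ p ≤ i ∧ i + 1 ≤ q ∧ q ≤ n + 1 ∧ E p - E q ∈ J
  have hDb : ∀ p q, D p q → 1 ≤ p ∧ p ≤ i ∧ i + 1 ≤ q ∧ q ≤ n + 1 :=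
    fun p q h => ⟨h.1, h.2.1, h.2.2.1, h.2.2.2.1⟩
  have hD : ∀ p q p' q', D p q → 1 ≤ p' → p' ≤ p → q ≤ q' → q' ≤ n + 1 → D p' q' := by
    rintro p q p' q' ⟨hp, hpi, hq, hqn, hpq⟩ hp' hpp hqq hq'
    refine ⟨hp', by omega, by omega, hq', hJideal _ hpq _ ?_ ?_⟩
    · rw [hΦpos]
      exact ⟨p', q', hp', by omega, hq', rfl⟩
    · rw [hrle]
      refine ⟨fun k => (if p' ≤ k ∧ k < p then 1 else 0) + (if q ≤ k ∧ k < q' then 1 else 0), ?_⟩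
      simp only [Nat.cast_add, add_smul, Finset.sum_add_distrib]
      rw [← sub_eq_sum_indicator_smul E hp' hpp (by omega),
        ← sub_eq_sum_indicator_smul E (by omega) hqq hq']
      abel
  have hJD : J ⊆ {y | ∃ p q, D p q ∧ y = E p - E q} := by
    intro y hy
    have hyM := hJM hy
    rw [hMi] at hyM
    obtain ⟨p, q, hp, hpi, hq, hqn, rfl⟩ := hyM
    exact ⟨p, q, ⟨hp, hpi, hq, hqn, hy⟩, rfl⟩
  obtain ⟨u, v, hu, hv, hu1, hv1, hle, rfl⟩ :=
    exists_marginals_of_mem_convexHull E hDb hD (convexHull_mono hJD hx)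
  obtain ⟨f, g, w, ⟨hf0, hg0, hfN, hgN, hs⟩, hDp, hw, hws, hwE⟩ :=
    hasPathWeight_of_marginals E hD ⟨hi1, le_rfl, by omega, le_rfl, h2⟩ (n - 1) 1 (i + 1) u v
      le_rfl hi1 (by omega) (by omega) ⟨le_rfl, hi1, le_rfl, by omega, h1⟩ hu hv
      (hu1.trans hv1.symm) hle
  refine ⟨fun k => f (k - 1), fun k => g (k - 1), ⟨hf0, hg0, hfN, hgN, ?_⟩, ?_, ?_⟩
  · intro k hk hkn
    have := hs (k - 1) (by omega)
    rwa [Nat.sub_add_cancel hk] at this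
  · rintro _ ⟨k, hk, hkn, rfl⟩
    exact (hDp (k - 1) (by omega)).2.2.2.2
  · rw [hwE]
    refine (convex_convexHull ℝ _).sum_mem (fun k _ => hw k) (hws.trans hu1) fun k hk => ?_
    refine subset_convexHull ℝ _ ⟨k + 1, by omega, ?_, rfl⟩
    rw [Finset.mem_range] at hk
    omega
end
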